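/- Let n ≥ 2, let Ω ⊂ ℝ^n be a bounded domain, and let H satisfy Conditions A and B with homogeneity exponent k = k₁ + 1. Let s, t ∈ ℝ with s ≤ t and |s| + |t| > 0. Suppose u is upper semicontinuous on cl(Ω) and is a viscosity subsolution of H(Du, D²u) = t in Ω (i.e. H(Du,D²u) ≥ t in the viscosity sense), and v is lower semicontinuous on cl(Ω) and is a viscosity supersolution of H(Dv, D²v) = s in Ω (i.e. H(Dv,D²v) ≤ s in the viscosity sense). Then u − v ≤ sup_{∂Ω} (u − v) in Ω. -/

import Mathlib

open Set Filter Metric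

noncomputable section

namespace DNLP

/-- Euclidean space ℝⁿ. -/
abbrev En (n : ℕ) := EuclideanSpace ℝ (Fin n)

/-- n×n real matrices (we use these for the symmetric matrices Sⁿ). -/
abbrev Sym (n : ℕ) := Matrix (Fin n) (Fin n) ℝ

variable {n : ℕ}

/-- Loewner order: X ≤ Y iff Y − X is positive semidefinite. -/
def LoewnerLE (X Y : Sym n) : Prop := (Y - X).PosSemidef

/-- Rank-one matrix p ⊗ q with entries pᵢ qⱼ. -/
def vouter (p q : En n) : Sym n := Matrix.of fun i j => p i * q j

/-- Spatial gradient of ψ(·,t) at y. -/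
def sgrad (ψ : En n → ℝ → ℝ) (y : En n) (t : ℝ) : En n :=
  gradient (fun x => ψ x t) y

/-- Spatial Hessian matrix of ψ(·,t) at y. -/
def shess (ψ : En n → ℝ → ℝ) (y : En n) (t : ℝ) : Sym n :=
  Matrix.of fun i j =>
    fderiv ℝ (fun x => fderiv ℝ (fun x' => ψ x' t) x (EuclideanSpace.single j (1:ℝ))) y
      (EuclideanSpace.single i (1:ℝ))

/-- Time derivative ψ_t at (y,t). -/
def tpartial (ψ : En n → ℝ → ℝ) (y : En n) (t : ℝ) : ℝ := deriv (fun s => ψ y s) t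

/-- Test functions: C² in x and C¹ in t. -/
def IsTestFn (ψ : En n → ℝ → ℝ) : Prop :=
  (∀ t, ContDiff ℝ 2 fun x => ψ x t) ∧ (∀ x, ContDiff ℝ 1 fun s => ψ x s)

/-- Condition A: continuity, H(p,0)=0 and degenerate ellipticity (monotonicity). -/
def CondA (H : En n → Sym n → ℝ) : Prop :=
  Continuous (fun q : En n × Sym n => H q.1 q.2) ∧
  (∀ p, H p 0 = 0) ∧
  ∀ (p : En n) (X Y : Sym n), LoewnerLE X Y → H p X ≤ H p Y

/-- Condition B: homogeneity of degree k₁ in the gradient and degree 1 in the Hessian. -/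
def CondB (H : En n → Sym n → ℝ) (k₁ : ℝ) : Prop :=
  0 ≤ k₁ ∧
  (∀ (θ : ℝ) (p : En n) (X : Sym n), H (θ • p) X = |θ| ^ k₁ * H p X) ∧
  ∀ (θ : ℝ), 0 < θ → ∀ (p : En n) (X : Sym n), H p (θ • X) = θ * H p X

/-- Condition C (coercivity): m(Λ) > 0 for Λ < 1 and M(Λ) < 0 for Λ ≥ Λ₁, expressed
pointwise over unit vectors (equivalent by compactness of the sphere and continuity). -/
def CondC (H : En n → Sym n → ℝ) : Prop :=
  (∀ Λ : ℝ, Λ < 1 → ∀ e : En n, ‖e‖ = 1 →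
      0 < H e (1 - Λ • vouter e e) ∧ H e (Λ • vouter e e - 1) < 0) ∧
  ∃ Λ₁ : ℝ, 1 ≤ Λ₁ ∧ ∀ Λ : ℝ, Λ₁ ≤ Λ → ∀ e : En n, ‖e‖ = 1 →
      H e (1 - Λ • vouter e e) < 0 ∧ 0 < H e (Λ • vouter e e - 1)

/-- Viscosity supersolution of H(Du,D²u) − u^{k−1} u_t = 0 on the set Q (Γ_k[u] ≤ 0). -/
def ParSuper (H : En n → Sym n → ℝ) (k : ℝ) (Q : Set (En n × ℝ)) (u : En n → ℝ → ℝ) : Prop :=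
  ∀ ψ : En n → ℝ → ℝ, IsTestFn ψ → ∀ y t, (y, t) ∈ Q →
    IsLocalMinOn (fun p : En n × ℝ => u p.1 p.2 - ψ p.1 p.2) Q (y, t) →
    H (sgrad ψ y t) (shess ψ y t) - u y t ^ (k - 1) * tpartial ψ y t ≤ 0

/-- Viscosity subsolution of H(Du,D²u) − u^{k−1} u_t = 0 on the set Q (Γ_k[u] ≥ 0). -/
def ParSub (H : En n → Sym n → ℝ) (k : ℝ) (Q : Set (En n × ℝ)) (u : En n → ℝ → ℝ) : Prop :=
  ∀ ψ : En n → ℝ → ℝ, IsTestFn ψ → ∀ y t, (y, t) ∈ Q →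
    IsLocalMaxOn (fun p : En n × ℝ => u p.1 p.2 - ψ p.1 p.2) Q (y, t) →
    0 ≤ H (sgrad ψ y t) (shess ψ y t) - u y t ^ (k - 1) * tpartial ψ y t

/-- The parabolic cylinder Ω_T = Ω × (0,T). -/
def pcyl (Ω : Set (En n)) (T : ℝ) : Set (En n × ℝ) := Ω ×ˢ Ioo 0 T

/-- The parabolic boundary P_T = (cl(Ω) × {0}) ∪ (∂Ω × [0,T)). -/
def pbdry (Ω : Set (En n)) (T : ℝ) : Set (En n × ℝ) :=
  (closure Ω ×ˢ ({0} : Set ℝ)) ∪ (frontier Ω ×ˢ Ico 0 T)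

/-- Ω_∞ = Ω × (0,∞). -/
def pcylInf (Ω : Set (En n)) : Set (En n × ℝ) := Ω ×ˢ Ioi 0

/-- P_∞ = (cl(Ω) × {0}) ∪ (∂Ω × [0,∞)). -/
def pbdryInf (Ω : Set (En n)) : Set (En n × ℝ) :=
  (closure Ω ×ˢ ({0} : Set ℝ)) ∪ (frontier Ω ×ˢ Ici 0)

/-- Viscosity subsolution of F(t,Du,D²u + Du⊗Du) − f(t) u_t = 0 on Q. -/
def ParSubF (F : ℝ → En n → Sym n → ℝ) (f : ℝ → ℝ) (Q : Set (En n × ℝ))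
    (u : En n → ℝ → ℝ) : Prop :=
  ∀ ψ : En n → ℝ → ℝ, IsTestFn ψ → ∀ y t, (y, t) ∈ Q →
    IsLocalMaxOn (fun p : En n × ℝ => u p.1 p.2 - ψ p.1 p.2) Q (y, t) →
    0 ≤ F t (sgrad ψ y t) (shess ψ y t + vouter (sgrad ψ y t) (sgrad ψ y t))
        - f t * tpartial ψ y t

/-- Viscosity supersolution of F(t,Du,D²u + Du⊗Du) − f(t) u_t = 0 on Q. -/
def ParSuperF (F : ℝ → En n → Sym n → ℝ) (f : ℝ → ℝ) (Q : Set (En n × ℝ))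
    (u : En n → ℝ → ℝ) : Prop :=
  ∀ ψ : En n → ℝ → ℝ, IsTestFn ψ → ∀ y t, (y, t) ∈ Q →
    IsLocalMinOn (fun p : En n × ℝ => u p.1 p.2 - ψ p.1 p.2) Q (y, t) →
    F t (sgrad ψ y t) (shess ψ y t + vouter (sgrad ψ y t) (sgrad ψ y t))
        - f t * tpartial ψ y t ≤ 0

/-- Viscosity subsolution of H(Dw, D²w + Dw⊗Dw) − w_t = 0 on Q. -/
def ParSubLog (H : En n → Sym n → ℝ) (Q : Set (En n × ℝ)) (w : En n → ℝ → ℝ) : Prop :=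
  ParSubF (fun _ p X => H p X) (fun _ => 1) Q w

/-- Viscosity supersolution of H(Dw, D²w + Dw⊗Dw) − w_t = 0 on Q. -/
def ParSuperLog (H : En n → Sym n → ℝ) (Q : Set (En n × ℝ)) (w : En n → ℝ → ℝ) : Prop :=
  ParSuperF (fun _ p X => H p X) (fun _ => 1) Q w

/-- Hessian matrix of φ : ℝⁿ → ℝ at y. -/
def ehess (φ : En n → ℝ) (y : En n) : Sym n :=
  Matrix.of fun i j =>
    fderiv ℝ (fun x => fderiv ℝ φ x (EuclideanSpace.single j (1:ℝ))) y
      (EuclideanSpace.single i (1:ℝ))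

/-- Elliptic viscosity condition H(Du,D²u) ≥ f in Ω (subsolution). -/
def EllSub (H : En n → Sym n → ℝ) (Ω : Set (En n)) (u : En n → ℝ) (f : En n → ℝ) : Prop :=
  ∀ φ : En n → ℝ, ContDiff ℝ 2 φ → ∀ y ∈ Ω,
    IsLocalMaxOn (fun x => u x - φ x) Ω y →
    f y ≤ H (gradient φ y) (ehess φ y)

/-- Elliptic viscosity condition H(Dv,D²v) ≤ f in Ω (supersolution). -/
def EllSuper (H : En n → Sym n → ℝ) (Ω : Set (En n)) (v : En n → ℝ) (f : En n → ℝ) : Prop :=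
  ∀ φ : En n → ℝ, ContDiff ℝ 2 φ → ∀ y ∈ Ω,
    IsLocalMinOn (fun x => v x - φ x) Ω y →
    H (gradient φ y) (ehess φ y) ≤ f y

/-- Uniform outer ball condition. -/
def UnifOuterBall (Ω : Set (En n)) : Prop :=
  ∃ ρ₀ : ℝ, 0 < ρ₀ ∧ ∀ y ∈ frontier Ω, ∃ q : En n,
    q ∉ Ω ∧ Metric.ball q ρ₀ ⊆ Ωᶜ ∧ y ∈ Metric.sphere q ρ₀

/-- Outer ball condition (radius may vary with the boundary point). -/
def OuterBallCond (Ω : Set (En n)) : Prop :=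
  ∀ y ∈ frontier Ω, ∃ ρ : ℝ, 0 < ρ ∧ ∃ q : En n,
    q ∉ Ω ∧ Metric.ball q ρ ⊆ Ωᶜ ∧ y ∈ Metric.sphere q ρ

section

open scoped RealInnerProductSpace Topology NNReal

section
variable {E : Type*} [NormedAddCommGroup E] [InnerProductSpace ℝ E]

/-- A function with two-sided quadratic bounds of slope `g` has a Lipschitz slope. -/
theorem lipschitzWith_of_quadratic_bound {h : E → ℝ} {g : E → E} {C : ℝ≥0}
    (hb : ∀ x y, |h y - h x - ⟪g x, y - x⟫| ≤ C * ‖y - x‖ ^ 2) :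
    LipschitzWith (6 * C) g := by
  refine LipschitzWith.of_dist_le_mul fun x y => ?_
  rcases eq_or_ne (g x) (g y) with hxy | hxy
  · rw [hxy, dist_self]; positivity
  have hC := C.coe_nonneg
  have hΔ : 0 < ‖g x - g y‖ := norm_pos_iff.2 (sub_ne_zero.2 hxy)
  rw [dist_eq_norm, dist_eq_norm, NNReal.coe_mul, NNReal.coe_ofNat]
  have key : ∀ w : E, ⟪g x - g y, w⟫ ≤ C * (3 * ‖x - y‖ ^ 2 + 3 * ‖w‖ ^ 2) := by
    intro w
    have h1 := abs_le.1 (hb y (x + w))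
    have h2 := abs_le.1 (hb x (x + w))
    have h3 := abs_le.1 (hb y x)
    have e1 : x + w - y = (x - y) + w := by abel
    have e2 : x + w - x = w := by abel
    rw [e1, inner_add_right] at h1
    rw [e2] at h2
    have h4 : ‖x - y + w‖ ^ 2 ≤ 2 * ‖x - y‖ ^ 2 + 2 * ‖w‖ ^ 2 := by
      nlinarith [norm_add_le (x - y) w, sq_nonneg (‖x - y‖ - ‖w‖), norm_nonneg (x - y + w),
        norm_nonneg (x - y), norm_nonneg w]
    rw [inner_sub_left]
    nlinarith [mul_le_mul_of_nonneg_left h4 hC]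
  have h5 := key ((‖x - y‖ / ‖g x - g y‖) • (g x - g y))
  rw [inner_smul_right, real_inner_self_eq_norm_sq, norm_smul, norm_div, norm_norm, norm_norm,
    div_mul_cancel₀ _ hΔ.ne'] at h5
  have h6 : ‖x - y‖ / ‖g x - g y‖ * ‖g x - g y‖ ^ 2 = ‖x - y‖ * ‖g x - g y‖ := by
    field_simp
  rw [h6] at h5
  rcases (norm_nonneg (x - y)).eq_or_lt' with h0 | h0
  · exact absurd (by rw [sub_eq_zero.1 (norm_eq_zero.1 h0)]) hxy
  · nlinarith

/-- A slope from below and a slope from above, up to quadratic errors, coincide. -/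
theorem slope_unique {h : E → ℝ} {x a b : E} {C₁ C₂ : ℝ}
    (ha : ∀ y, h x + ⟪a, y - x⟫ - C₁ * ‖y - x‖ ^ 2 ≤ h y)
    (hb : ∀ y, h y ≤ h x + ⟪b, y - x⟫ + C₂ * ‖y - x‖ ^ 2) : a = b := by
  by_contra hne
  have hΔ : 0 < ‖a - b‖ ^ 2 := by have := norm_pos_iff.2 (sub_ne_zero.2 hne); positivity
  set C := |C₁ + C₂| + 1 with hC
  have hC0 : 0 < C := by positivity
  have h1 := (ha (x + (1 / C) • (a - b))).trans (hb _)
  rw [add_sub_cancel_left, norm_smul, inner_smul_right, inner_smul_right, mul_pow,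
    Real.norm_eq_abs, sq_abs] at h1
  have h2 : ⟪a, a - b⟫ - ⟪b, a - b⟫ = ‖a - b‖ ^ 2 := by
    rw [← inner_sub_left, real_inner_self_eq_norm_sq]
  have h3 : (1 / C) * ‖a - b‖ ^ 2 ≤ (C₁ + C₂) * ((1 / C) ^ 2 * ‖a - b‖ ^ 2) := by
    rw [← h2, mul_sub (1 / C), h2]; linarith
  have h4 : (C₁ + C₂) * ((1 / C) ^ 2 * ‖a - b‖ ^ 2) < C * ((1 / C) ^ 2 * ‖a - b‖ ^ 2) := by
    apply mul_lt_mul_of_pos_right _ (by positivity)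
    rw [hC]; linarith [le_abs_self (C₁ + C₂)]
  have h5 : C * ((1 / C) ^ 2 * ‖a - b‖ ^ 2) = (1 / C) * ‖a - b‖ ^ 2 := by field_simp
  linarith

theorem hasGradientAt_of_quadratic_bound [CompleteSpace E] {h : E → ℝ} {x q : E} {C : ℝ}
    (hb : ∀ y, |h y - h x - ⟪q, y - x⟫| ≤ C * ‖y - x‖ ^ 2) : HasGradientAt h q x := by
  rw [hasGradientAt_iff_isLittleO]
  have h1 : (fun y => h y - h x - ⟪q, y - x⟫) =O[𝓝 x] fun y => ‖y - x‖ ^ 2 :=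
    Asymptotics.IsBigO.of_bound C (Eventually.of_forall fun y => by
      simpa using hb y)
  refine h1.trans_isLittleO ?_
  have h2 : (fun y : E => ‖y - x‖ ^ 2) =o[𝓝 x] fun y => ‖y - x‖ := by
    have h3 : Tendsto (fun y : E => ‖y - x‖) (𝓝 x) (𝓝 0) := tendsto_norm_sub_self x
    have := (Asymptotics.isLittleO_pow_id (𝕜 := ℝ) one_lt_two).comp_tendsto h3
    exact this
  exact h2.of_norm_right

theorem derivative_of_gradient_symmetric [CompleteSpace E] {h : E → ℝ} {g : E → E}
    {A : E →L[ℝ] E} {x : E}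
    (hg : ∀ y, HasGradientAt h (g y) y) (hA : HasFDerivAt g A x) (v w : E) :
    ⟪A v, w⟫ = ⟪A w, v⟫ := by
  have h1 : ∀ y, HasFDerivAt h (InnerProductSpace.toDual ℝ E (g y)) y := fun y =>
    (hg y).hasFDerivAt
  have h2 : HasFDerivAt (fun y => InnerProductSpace.toDual ℝ E (g y))
      ((InnerProductSpace.toDual ℝ E).toContinuousLinearEquiv.toContinuousLinearMap.comp A) x :=
    (InnerProductSpace.toDual ℝ E).toContinuousLinearEquiv.toContinuousLinearMap.hasFDerivAt.comp
      x hA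
  simpa using second_derivative_symmetric h1 h2 v w

/-- Second-order expansion at a point where the gradient is differentiable. -/
theorem second_order_expansion [CompleteSpace E] {h : E → ℝ} {g : E → E} {A : E →L[ℝ] E} {x : E}
    (hg : ∀ y, HasGradientAt h (g y) y) (hA : HasFDerivAt g A x)
    {η : ℝ} (hη : 0 < η) :
    ∀ᶠ d in 𝓝 (0 : E), |h (x + d) - h x - ⟪g x, d⟫ - (1 / 2) * ⟪A d, d⟫| ≤ η * ‖d‖ ^ 2 := by
  have hsym := derivative_of_gradient_symmetric hg hA
  have h1 := hasFDerivAt_iff_isLittleO_nhds_zero.1 hA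
  obtain ⟨r, hr, hball⟩ := Metric.eventually_nhds_iff.1 (h1.def hη)
  refine Metric.eventually_nhds_iff.2 ⟨r, hr, fun d hd => ?_⟩
  rw [dist_zero_right] at hd
  have hder : ∀ z, HasGradientAt (fun z => h (x + z) - ⟪g x, z⟫ - (1 / 2) * ⟪A z, z⟫)
      (g (x + z) - g x - A z) z := by
    intro z
    have e1 := ((hg (x + z)).hasFDerivAt).comp z ((hasFDerivAt_id z).const_add x)
    have e2 := (hasFDerivAt_const (g x) z).inner ℝ (hasFDerivAt_id z)
    have e3 := (A.hasFDerivAt (x := z)).inner ℝ (hasFDerivAt_id z)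
    rw [hasGradientAt_iff_hasFDerivAt]
    refine ((e1.sub e2).sub (e3.const_mul (1 / 2))).congr_fderiv ?_
    ext w
    have := hsym w z
    simp
    linarith
  have hmv := (convex_closedBall (0 : E) ‖d‖).norm_image_sub_le_of_norm_hasFDerivWithin_le
    (C := η * ‖d‖) (fun z _ => ((hder z).hasFDerivAt).hasFDerivWithinAt)
    (fun z hz => by
      rw [mem_closedBall_zero_iff] at hz
      rw [LinearIsometryEquiv.norm_map]
      refine (hball (y := z) ?_).trans (by gcongr)
      rw [dist_zero_right]; exact hz.trans_lt hd)
    (x := 0) (y := d) (by simp) (by simp)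
  simp only [Real.norm_eq_abs, sub_zero, add_zero, inner_zero_right, mul_zero] at hmv
  calc _ = _ := by congr 1; ring
    _ ≤ _ := hmv
    _ = _ := by ring

end

section
variable {n : ℕ}

/-- The matrix of the quadratic form `⟪A ·, ·⟫`. -/
def formMatrix (A : En n →L[ℝ] En n) : Sym n :=
  Matrix.of fun i j => ⟪A (EuclideanSpace.single i (1 : ℝ)), EuclideanSpace.single j (1 : ℝ)⟫

theorem continuous_formMatrix : Continuous (formMatrix (n := n)) := by
  refine continuous_matrix fun i j => ?_
  simp only [formMatrix, Matrix.of_apply]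
  fun_prop

theorem formMatrix_neg (A : En n →L[ℝ] En n) : formMatrix (-A) = -formMatrix A := by
  ext i j; simp [formMatrix]

theorem hasGradientAt_quadratic {B : En n →L[ℝ] En n} (hB : ∀ v w, ⟪B v, w⟫ = ⟪B w, v⟫)
    (q y x : En n) :
    HasGradientAt (fun x => ⟪q, x - y⟫ + (1 / 2) * ⟪B (x - y), x - y⟫) (q + B (x - y)) x := by
  have e2 := (hasFDerivAt_const q x).inner ℝ ((hasFDerivAt_id x).sub_const y)
  have e3 := ((B.hasFDerivAt).comp x ((hasFDerivAt_id x).sub_const y)).inner ℝ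
    ((hasFDerivAt_id x).sub_const y)
  rw [hasGradientAt_iff_hasFDerivAt]
  refine (e2.add (e3.const_mul (1 / 2))).congr_fderiv ?_
  ext w
  have := hB w (x - y)
  simp [inner_sub_left] at this ⊢
  linarith

theorem ehess_quadratic {B : En n →L[ℝ] En n} (hB : ∀ v w, ⟪B v, w⟫ = ⟪B w, v⟫) (q y : En n) :
    ehess (fun x => ⟪q, x - y⟫ + (1 / 2) * ⟪B (x - y), x - y⟫) y = formMatrix B := by
  ext i j
  simp only [ehess, formMatrix, Matrix.of_apply]
  have h1 : (fun x => fderiv ℝ (fun x => ⟪q, x - y⟫ + (1 / 2) * ⟪B (x - y), x - y⟫) x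
      (EuclideanSpace.single j (1 : ℝ))) =
      fun x => ⟪q + B (x - y), EuclideanSpace.single j (1 : ℝ)⟫ := by
    funext x
    rw [(hasGradientAt_quadratic hB q y x).hasFDerivAt.fderiv, InnerProductSpace.toDual_apply_apply]
  have h2 := (((B.hasFDerivAt).comp y ((hasFDerivAt_id y).sub_const y)).const_add q).inner ℝ
    (hasFDerivAt_const (EuclideanSpace.single j (1 : ℝ)) y)
  rw [h1]
  erw [h2.fderiv]
  simp

/-- A subsolution satisfies the differential inequality at every second-order upper jet. -/
theorem EllSub.le_of_upper_jet {H : En n → Sym n → ℝ}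
    (hH : Continuous fun q : En n × Sym n => H q.1 q.2) {Ω : Set (En n)} {u : En n → ℝ} {t : ℝ}
    (hsub : EllSub H Ω u fun _ => t) {y q : En n} (hy : y ∈ Ω) {A : En n →L[ℝ] En n}
    (hA : ∀ v w, ⟪A v, w⟫ = ⟪A w, v⟫)
    (hjet : ∀ η : ℝ, 0 < η → ∀ᶠ d in 𝓝 (0 : En n), y + d ∈ Ω →
      u (y + d) ≤ u y + ⟪q, d⟫ + (1 / 2) * ⟪A d, d⟫ + η * ‖d‖ ^ 2) :
    t ≤ H q (formMatrix A) := by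
  have key : ∀ η : ℝ, 0 < η → t ≤ H q (formMatrix (A + (2 * η) • ContinuousLinearMap.id ℝ (En n))) := by
    intro η hη
    set B := A + (2 * η) • ContinuousLinearMap.id ℝ (En n) with hBdef
    have hB : ∀ v w, ⟪B v, w⟫ = ⟪B w, v⟫ := by
      intro v w
      simp [hBdef, inner_add_left, inner_smul_left, hA v w, real_inner_comm v w]
    have h1 := hsub (fun x => ⟪q, x - y⟫ + (1 / 2) * ⟪B (x - y), x - y⟫)
      (by
        have h0 : ContDiff ℝ 2 fun x : En n => x - y := by fun_prop
        exact (contDiff_const.inner ℝ h0).add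
          (contDiff_const.mul ((B.contDiff.comp h0).inner ℝ h0))) y hy ?_
    · rwa [(hasGradientAt_quadratic hB q y y).gradient, ehess_quadratic hB, sub_self, map_zero,
        add_zero] at h1
    · have ht : Tendsto (fun x => x - y) (𝓝 y) (𝓝 0) := by
        simpa using (continuous_id.sub continuous_const).tendsto (x := y) (f := fun x => x - y)
      refine eventually_nhdsWithin_iff.2 ?_
      filter_upwards [ht.eventually (hjet η hη)] with x hx hxΩ
      have h2 := hx (by simpa using hxΩ)
      simp only [add_sub_cancel] at h2
      simp only [hBdef, sub_self, map_zero, inner_zero_right, add_apply,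
        smul_apply, ContinuousLinearMap.id_apply, inner_add_left,
        real_inner_smul_left, real_inner_self_eq_norm_sq]
      linarith
  have hlim : Tendsto (fun η : ℝ => H q (formMatrix (A + (2 * η) • ContinuousLinearMap.id ℝ (En n))))
      (𝓝[>] 0) (𝓝 (H q (formMatrix A))) := by
    have hc : Continuous fun η : ℝ =>
        H q (formMatrix (A + (2 * η) • ContinuousLinearMap.id ℝ (En n))) :=
      hH.comp (continuous_const.prodMk (continuous_formMatrix.comp (by fun_prop)))
    have h0 := (hc.tendsto 0).mono_left (nhdsWithin_le_nhds (s := Ioi 0))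
    have hz : A + (2 * (0 : ℝ)) • ContinuousLinearMap.id ℝ (En n) = A := by ext; simp
    rwa [hz] at h0
  exact ge_of_tendsto hlim (eventually_nhdsWithin_of_forall fun η hη => key η hη)

/-- The negative of a supersolution is a subsolution of the reflected equation. -/
theorem EllSuper.neg {H : En n → Sym n → ℝ} {Ω : Set (En n)} {v : En n → ℝ} {s : ℝ}
    (hv : EllSuper H Ω v fun _ => s) :
    EllSub (fun p X => -H (-p) (-X)) Ω (fun x => -v x) fun _ => -s := by
  intro φ hφ y hy hmax
  have h1 := hv (fun x => -φ x) hφ.neg y hy (by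
    filter_upwards [hmax] with x hx
    linarith)
  have hg : gradient (fun x => -φ x) y = -gradient φ y := by
    simp [gradient]
  have hh : ehess (fun x => -φ x) y = -ehess φ y := by
    ext i j
    simp [ehess]
  rw [hg, hh] at h1
  exact neg_le_neg h1

end

section
variable {E : Type*} [NormedAddCommGroup E] [InnerProductSpace ℝ E]

/-- The identities behind the semiconvexity of the double envelope. -/
theorem quadratic_midpoint_ineq {c : ℝ} (hc : 0 < c) (x d y z₁ z₂ : E) :
    -c * ‖(1 / 2 : ℝ) • (z₁ + z₂) - y‖ ^ 2 * 2 + 2 * (2 * c * ‖x - (1 / 2 : ℝ) • (z₁ + z₂)‖ ^ 2)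
      - 4 * c * ‖d‖ ^ 2 ≤
    (-c * ‖z₁ - y‖ ^ 2 + 2 * c * ‖x + d - z₁‖ ^ 2) +
      (-c * ‖z₂ - y‖ ^ 2 + 2 * c * ‖x - d - z₂‖ ^ 2) := by
  set m := (1 / 2 : ℝ) • (z₁ + z₂) with hm
  set f := (1 / 2 : ℝ) • (z₁ - z₂) with hf
  have e1 : z₁ - y = (m - y) + f := by rw [hm, hf]; module
  have e2 : z₂ - y = (m - y) - f := by rw [hm, hf]; module
  have e3 : x + d - z₁ = (x - m) + (d - f) := by rw [hm, hf]; module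
  have e4 : x - d - z₂ = (x - m) - (d - f) := by rw [hm, hf]; module
  have h1 := parallelogram_law_with_norm ℝ (m - y) f
  have h2 := parallelogram_law_with_norm ℝ (x - m) (d - f)
  have h3 : ‖f - (2 : ℝ) • d‖ ^ 2 = ‖f‖ ^ 2 - 4 * ⟪d, f⟫ + 4 * ‖d‖ ^ 2 := by
    rw [norm_sub_sq_real, real_inner_smul_right, norm_smul (2 : ℝ) d, Real.norm_ofNat,
      real_inner_comm d f]
    ring
  have h4 := norm_sub_sq_real d f
  have h5 : 0 ≤ c * ‖f - (2 : ℝ) • d‖ ^ 2 := by positivity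
  rw [e1, e2, e3, e4]
  rw [h3] at h5
  nlinarith [congrArg (c * ·) h1, congrArg (c * ·) h2, congrArg (c * ·) h4]

/-- The double quadratic envelope of an upper semicontinuous function on a compact set: a
function with two-sided quadratic bounds, lying above all the downward paraboloids centred on the
graph, and below every upward paraboloid that lies above those. -/
theorem exists_double_envelope [FiniteDimensional ℝ E] {Q : Set E} (hQ : IsCompact Q)
    (hne : Q.Nonempty) {u : E → ℝ} (hu : UpperSemicontinuousOn u Q) {c : ℝ} (hc : 0 < c) :
    ∃ (h : E → ℝ) (g : E → E),
      (∀ x y, |h y - h x - ⟪g x, y - x⟫| ≤ 6 * c * ‖y - x‖ ^ 2) ∧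
      (∀ x, ∀ y ∈ Q, u y - 2 * c * ‖x - y‖ ^ 2 ≤ h x) ∧
      ∀ (b : ℝ) (p z : E),
        (∀ x, ∀ y ∈ Q, u y - 2 * c * ‖x - y‖ ^ 2 ≤ b + ⟪p, x⟫ + 2 * c * ‖x - z‖ ^ 2) →
        ∀ x, h x ≤ b + ⟪p, x⟫ + 2 * c * ‖x - z‖ ^ 2 := by
  have hmax : ∀ z : E, ∃ y ∈ Q, ∀ y' ∈ Q, u y' - c * ‖z - y'‖ ^ 2 ≤ u y - c * ‖z - y‖ ^ 2 := by
    intro z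
    have h1 : UpperSemicontinuousOn (fun y => u y + -(c * ‖z - y‖ ^ 2)) Q :=
      hu.add ((Continuous.upperSemicontinuous (by fun_prop)).upperSemicontinuousOn Q)
    obtain ⟨y, hy, hym⟩ := h1.exists_isMaxOn hne hQ
    exact ⟨y, hy, fun y' hy' => by have := hym hy'; simp only [mem_ofPred_eq] at this; linarith⟩
  choose Y hYQ hY using hmax
  set U : E → ℝ := fun z => u (Y z) - c * ‖z - Y z‖ ^ 2 with hU
  have hUlsc : LowerSemicontinuous U := by
    intro z a ha
    have h1 : Continuous fun z' => u (Y z) - c * ‖z' - Y z‖ ^ 2 := by fun_prop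
    filter_upwards [h1.continuousAt.eventually_const_lt ha] with z' hz'
    exact hz'.trans_le (hY z' _ (hYQ z))
  obtain ⟨y₀, hy₀⟩ := hne
  have hmin : ∀ x : E, ∃ z, ∀ z', U z + 2 * c * ‖x - z‖ ^ 2 ≤ U z' + 2 * c * ‖x - z'‖ ^ 2 := by
    intro x
    set D := ‖x - y₀‖ with hD
    set B := |U x - u y₀| / c with hB
    have hB0 : 0 ≤ B := by positivity
    have hD0 : 0 ≤ D := norm_nonneg _
    set R := 2 * D + 1 + D ^ 2 + B with hR
    have h1 : LowerSemicontinuousOn (fun z => U z + 2 * c * ‖x - z‖ ^ 2) (closedBall x R) :=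
      (hUlsc.add (Continuous.lowerSemicontinuous (by fun_prop))).lowerSemicontinuousOn _
    have hxR : x ∈ closedBall x R := mem_closedBall_self (by positivity)
    obtain ⟨z, hz, hzm⟩ := h1.exists_isMinOn ⟨x, hxR⟩ (isCompact_closedBall x R)
    refine ⟨z, fun z' => ?_⟩
    by_cases hz' : z' ∈ closedBall x R
    · exact hzm hz'
    have h2 := hzm hxR
    simp only [mem_ofPred_eq, sub_self, norm_zero] at h2
    have h3 := hY z' y₀ hy₀
    rw [mem_closedBall', dist_eq_norm, not_le] at hz'
    have h4 : ‖z' - y₀‖ ≤ ‖x - z'‖ + D := by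
      rw [norm_sub_rev x z']; simpa using norm_add_le (z' - x) (x - y₀)
    set r := ‖x - z'‖
    have h5 : ‖z' - y₀‖ ^ 2 ≤ (r + D) ^ 2 := by gcongr
    have h6 : B ≤ 2 * r ^ 2 - (r + D) ^ 2 := by nlinarith
    have h7 : U x - u y₀ ≤ c * B := by
      rw [hB, mul_div_cancel₀ _ hc.ne']; exact le_abs_self _
    have h8 : U z' = u (Y z') - c * ‖z' - Y z'‖ ^ 2 := rfl
    nlinarith [mul_le_mul_of_nonneg_left h5 hc.le, mul_le_mul_of_nonneg_left h6 hc.le]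
  choose Z hZ using hmin
  set h : E → ℝ := fun x => U (Z x) + 2 * c * ‖x - Z x‖ ^ 2 with hh
  have hle : ∀ x z, h x ≤ U z + 2 * c * ‖x - z‖ ^ 2 := hZ
  have hupper : ∀ x y, h y ≤ h x + ⟪(4 * c) • (x - Z x), y - x⟫ + 2 * c * ‖y - x‖ ^ 2 := by
    intro x y
    refine (hle y (Z x)).trans (le_of_eq ?_)
    have e : y - Z x = (x - Z x) + (y - x) := by abel
    rw [e, norm_add_sq_real, real_inner_smul_left, hh]
    ring
  have hmid : ∀ x d, 2 * h x - 4 * c * ‖d‖ ^ 2 ≤ h (x + d) + h (x - d) := by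
    intro x d
    set z₁ := Z (x + d)
    set z₂ := Z (x - d)
    have h1 := hle x ((1 / 2 : ℝ) • (z₁ + z₂))
    have h2 := hY z₁ _ (hYQ ((1 / 2 : ℝ) • (z₁ + z₂)))
    have h3 := hY z₂ _ (hYQ ((1 / 2 : ℝ) • (z₁ + z₂)))
    have h4 := quadratic_midpoint_ineq hc x d (Y ((1 / 2 : ℝ) • (z₁ + z₂))) z₁ z₂
    simp only [hh, hU] at h1 h2 h3 ⊢
    linarith
  refine ⟨h, fun x => (4 * c) • (x - Z x), fun x y => ?_, fun x y hy => ?_, fun b p z hbd x => ?_⟩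
  · have h1 := hmid x (y - x)
    have h2 := hupper x (x - (y - x))
    have h3 := hupper x y
    have e1 : x + (y - x) = y := by abel
    have e2 : x - (y - x) - x = -(y - x) := by abel
    rw [e1] at h1
    rw [e2, inner_neg_right, norm_neg] at h2
    have h4 : 0 ≤ c * ‖y - x‖ ^ 2 := by positivity
    rw [abs_le]
    constructor <;> linarith
  · have h1 := hY (Z x) y hy
    have e : Z x - y = (x - y) - (x - Z x) := by abel
    have h2 : ‖Z x - y‖ ^ 2 ≤ 2 * ‖x - y‖ ^ 2 + 2 * ‖x - Z x‖ ^ 2 := by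
      rw [e]
      nlinarith [norm_sub_le (x - y) (x - Z x), sq_nonneg (‖x - y‖ - ‖x - Z x‖),
        norm_nonneg (x - y - (x - Z x)), norm_nonneg (x - y), norm_nonneg (x - Z x)]
    simp only [hh, hU] at h1 ⊢
    nlinarith [mul_le_mul_of_nonneg_left h2 hc.le]
  · set w := z - (1 / (4 * c)) • p with hw
    have hsq : ∀ x, b + ⟪p, x⟫ + 2 * c * ‖x - z‖ ^ 2 =
        (b + ⟪p, z⟫ - 1 / (8 * c) * ‖p‖ ^ 2) + 2 * c * ‖x - w‖ ^ 2 := by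
      intro x
      have e : x - w = (x - z) + (1 / (4 * c)) • p := by rw [hw]; abel
      rw [e, norm_add_sq_real, real_inner_smul_right, norm_smul, mul_pow, Real.norm_eq_abs, sq_abs,
        inner_sub_left, real_inner_comm p x, real_inner_comm p z]
      field_simp
      ring
    rw [hsq]
    refine (hle x w).trans (add_le_add_left ?_ _)
    have h1 := hbd ((1 / 2 : ℝ) • (Y w + w)) (Y w) (hYQ w)
    rw [hsq] at h1
    have e1 : (1 / 2 : ℝ) • (Y w + w) - Y w = (1 / 2 : ℝ) • (w - Y w) := by module
    have e2 : (1 / 2 : ℝ) • (Y w + w) - w = -((1 / 2 : ℝ) • (w - Y w)) := by module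
    rw [e1, e2, norm_neg, norm_smul, mul_pow] at h1
    norm_num at h1
    simp only [hU]
    norm_num
    linarith
end

section
variable {E : Type*} [NormedAddCommGroup E] [InnerProductSpace ℝ E]

open MeasureTheory Measure in
/-- If a Lipschitz map sends a set onto a ball, every Lipschitz map is differentiable at some point
of that set. -/
theorem exists_differentiableAt_of_ball_subset_image [FiniteDimensional ℝ E] [MeasurableSpace E]
    [BorelSpace E] {F g : E → E} {C C' : ℝ≥0} (hF : LipschitzWith C F) (hg : LipschitzWith C' g)
    {K : Set E} {δ : ℝ} (hδ : 0 < δ) (hK : ball 0 δ ⊆ F '' K) :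
    ∃ x ∈ K, DifferentiableAt ℝ g x := by
  by_contra! hcon
  have h1 : μH[Module.finrank ℝ E] K = 0 := measure_mono_null (fun x hx => hcon x hx)
    (ae_iff.1 (hg.ae_differentiableAt (μ := μH[Module.finrank ℝ E])))
  have h2 := hF.hausdorffMeasure_image_le (d := Module.finrank ℝ E) (by positivity) K
  rw [h1, mul_zero] at h2
  exact (measure_ball_pos (μH[Module.finrank ℝ E]) (0 : E) hδ).ne'
    (measure_mono_null hK (le_antisymm h2 bot_le))

/-- For a large penalization and a small slope, the doubled maximum is attained in the interior. -/
theorem exists_interior_maximizers {Ω : Set E} (hΩo : IsOpen Ω) (hΩk : IsCompact (closure Ω))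
    {u w : E → ℝ} (hu : UpperSemicontinuousOn u (closure Ω))
    (hw : UpperSemicontinuousOn w (closure Ω)) {x₀ : E} (hx₀ : x₀ ∈ Ω) {m : ℝ}
    (hm : m < u x₀ + w x₀) (hfr : ∀ y ∈ frontier Ω, u y + w y ≤ m) :
    ∃ c > 0, ∃ δ > 0, ∀ p : E, ‖p‖ < δ → ∃ y ∈ Ω, ∃ y' ∈ Ω, ∀ z ∈ closure Ω, ∀ z' ∈ closure Ω,
      u z + w z' - c * ‖z - z'‖ ^ 2 - ⟪p, (1 / 2 : ℝ) • (z + z')⟫ ≤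
        u y + w y' - c * ‖y - y'‖ ^ 2 - ⟪p, (1 / 2 : ℝ) • (y + y')⟫ := by
  obtain ⟨R, hR0, hR⟩ := hΩk.isBounded.exists_pos_norm_le
  have hQ := hΩk.prod hΩk
  have hsum : UpperSemicontinuousOn (fun q : E × E => u q.1 + w q.2) (closure Ω ×ˢ closure Ω) :=
    (hu.comp continuousOn_fst fun _ hq => hq.1).add (hw.comp continuousOn_snd fun _ hq => hq.2)
  obtain ⟨M, hM⟩ := hsum.bddAbove_of_isCompact hQ
  set α := (u x₀ + w x₀ - m) / 2 with hα
  have hα0 : 0 < α := by rw [hα]; linarith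
  have hK := (hsum.isCompact_inter_preimage_Ici hQ (m + α)).inter_right
    ((hΩo.isClosed_compl.preimage continuous_fst).union
      (hΩo.isClosed_compl.preimage continuous_snd) : IsClosed (_ : Set (E × E)))
  obtain ⟨ε, hε, hεK⟩ := hK.exists_forall_le' (f := fun q : E × E => ‖q.1 - q.2‖) (a := 0)
    (by fun_prop) (by
      rintro ⟨a, b⟩ ⟨⟨⟨ha, hb⟩, hab⟩, hor⟩
      refine norm_pos_iff.2 fun h0 => ?_
      obtain rfl : a = b := sub_eq_zero.1 h0
      have hafr : a ∈ frontier Ω := by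
        rw [hΩo.frontier_eq]
        exact ⟨ha, hor.elim id id⟩
      have h1 := hfr a hafr
      have h2 : m + α ≤ u a + w a := hab
      linarith)
  set c := (|M - m| + 1) / ε ^ 2 with hc
  have hc0 : 0 < c := by positivity
  refine ⟨c, hc0, α / (2 * R), by positivity, fun p hp => ?_⟩
  have hpR : ‖p‖ * (2 * R) < α := (lt_div_iff₀ (by positivity)).1 hp
  have hpz : ∀ z ∈ closure Ω, ∀ z' ∈ closure Ω, |⟪p, (1 / 2 : ℝ) • (z + z')⟫| ≤ ‖p‖ * R := by
    intro z hz z' hz'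
    refine (abs_real_inner_le_norm _ _).trans (mul_le_mul_of_nonneg_left ?_ (norm_nonneg _))
    rw [norm_smul, Real.norm_eq_abs, abs_of_pos (by norm_num)]
    linarith [norm_add_le z z', hR z hz, hR z' hz']
  have hpen : UpperSemicontinuousOn (fun q : E × E => u q.1 + w q.2 +
      -(c * ‖q.1 - q.2‖ ^ 2 + ⟪p, (1 / 2 : ℝ) • (q.1 + q.2)⟫)) (closure Ω ×ˢ closure Ω) :=
    hsum.add ((Continuous.upperSemicontinuous (by fun_prop)).upperSemicontinuousOn _)
  have hx₀' := subset_closure hx₀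
  obtain ⟨⟨y, y'⟩, ⟨hy, hy'⟩, hmax⟩ := hpen.exists_isMaxOn ⟨(x₀, x₀), mk_mem_prod hx₀' hx₀'⟩ hQ
  have hmax' : ∀ z ∈ closure Ω, ∀ z' ∈ closure Ω,
      u z + w z' - c * ‖z - z'‖ ^ 2 - ⟪p, (1 / 2 : ℝ) • (z + z')⟫ ≤
        u y + w y' - c * ‖y - y'‖ ^ 2 - ⟪p, (1 / 2 : ℝ) • (y + y')⟫ := by
    intro z hz z' hz'
    have := hmax (mk_mem_prod hz hz')
    simp only [mem_ofPred_eq] at this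
    linarith
  have h0 := hmax' x₀ hx₀' x₀ hx₀'
  rw [sub_self, norm_zero] at h0
  have h1 := abs_le.1 (hpz x₀ hx₀' x₀ hx₀')
  have h2 := abs_le.1 (hpz y hy y' hy')
  have h3 : m + α + c * ‖y - y'‖ ^ 2 ≤ u y + w y' := by
    rw [hα] at hpR ⊢; linarith
  have h4 : u y + w y' ≤ M := 
    hM (mem_image_of_mem (fun q : E × E => u q.1 + w q.2) (mk_mem_prod hy hy'))
  have hinter : ¬(y ∈ Ωᶜ ∨ y' ∈ Ωᶜ) := by
    intro hor
    have h5 : ε ≤ ‖y - y'‖ := hεK (y, y') ⟨⟨⟨hy, hy'⟩, by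
      have : 0 ≤ c * ‖y - y'‖ ^ 2 := by positivity
      change m + α ≤ u y + w y'
      linarith⟩, hor⟩
    have h6 : c * ε ^ 2 ≤ c * ‖y - y'‖ ^ 2 := by gcongr
    rw [hc, div_mul_cancel₀ _ (by positivity), ← hc] at h6
    linarith [le_abs_self (M - m)]
  simp only [mem_compl_iff, not_or, not_not] at hinter
  exact ⟨y, hinter.1, y', hinter.2, hmax'⟩

/-- Completing the square in the intermediate point of the doubled functional. -/
theorem doubled_square_identity {c : ℝ} (hc : 0 < c) (p x y y' : E) :
    2 * c * ‖x - y‖ ^ 2 + 2 * c * ‖x - y'‖ ^ 2 + ⟪p, x⟫ =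
      c * ‖y - y'‖ ^ 2 + ⟪p, (1 / 2 : ℝ) • (y + y')⟫ - 1 / (16 * c) * ‖p‖ ^ 2 +
        4 * c * ‖x - ((1 / 2 : ℝ) • (y + y') - (1 / (8 * c)) • p)‖ ^ 2 := by
  set b := x - (1 / 2 : ℝ) • (y + y') with hb
  have e1 : x - y = b - (1 / 2 : ℝ) • (y - y') := by rw [hb]; module
  have e2 : x - y' = b + (1 / 2 : ℝ) • (y - y') := by rw [hb]; module
  have e3 : x - ((1 / 2 : ℝ) • (y + y') - (1 / (8 * c)) • p) = b + (1 / (8 * c)) • p := by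
    rw [hb]; abel
  have e4 : x = b + (1 / 2 : ℝ) • (y + y') := by rw [hb]; abel
  have h1 : ⟪p, x⟫ = ⟪p, b⟫ + ⟪p, (1 / 2 : ℝ) • (y + y')⟫ := by
    rw [← inner_add_right, ← e4]
  rw [h1, e1, e2, e3, norm_sub_sq_real, norm_add_sq_real, norm_add_sq_real,
    norm_smul, norm_smul, real_inner_smul_right b p, mul_pow, mul_pow, Real.norm_eq_abs,
    Real.norm_eq_abs, sq_abs, sq_abs, real_inner_comm b p]
  field_simp
  ring

/-- A quadratically bounded function touched from below by a downward paraboloid. -/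
theorem slope_eq_of_touching {h : E → ℝ} {g : E → E} {C c a : ℝ} {x y : E}
    (hb : ∀ z, |h z - h x - ⟪g x, z - x⟫| ≤ C * ‖z - x‖ ^ 2)
    (hlow : ∀ z, a - 2 * c * ‖z - y‖ ^ 2 ≤ h z) (heq : h x = a - 2 * c * ‖x - y‖ ^ 2) :
    g x = (4 * c) • (y - x) := by
  refine (slope_unique (h := h) (x := x) (C₁ := 2 * c) (C₂ := C) (fun z => ?_) fun z => ?_).symm
  · have h1 := hlow z
    have e : z - y = (z - x) - (y - x) := by abel
    rw [e, norm_sub_sq_real, real_inner_comm] at h1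
    rw [heq, real_inner_smul_left, norm_sub_rev x y]
    linarith
  · linarith [(abs_le.1 (hb z)).2]

end

section
variable {E : Type*} [NormedAddCommGroup E] [InnerProductSpace ℝ E]

/-- `(q, A)` is a second-order upper jet of `u` at `y` relative to `Ω`. -/
def IsUpperJet (Ω : Set E) (u : E → ℝ) (y q : E) (A : E →L[ℝ] E) : Prop :=
  ∀ η : ℝ, 0 < η → ∀ᶠ d in 𝓝 (0 : E), y + d ∈ Ω →
    u (y + d) ≤ u y + ⟪q, d⟫ + (1 / 2) * ⟪A d, d⟫ + η * ‖d‖ ^ 2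

/-- At an interior positive maximum of `u + w` there are almost opposite upper jets of `u` and `w`
at interior points, with uniform bounds. -/
theorem exists_opposite_jets [FiniteDimensional ℝ E] {Ω : Set E} (hΩo : IsOpen Ω)
    (hΩk : IsCompact (closure Ω)) {u w : E → ℝ} (hu : UpperSemicontinuousOn u (closure Ω))
    (hw : UpperSemicontinuousOn w (closure Ω)) {x₀ : E} (hx₀ : x₀ ∈ Ω) {m : ℝ}
    (hm : m < u x₀ + w x₀) (hfr : ∀ y ∈ frontier Ω, u y + w y ≤ m) :
    ∃ R L : ℝ, ∀ ε > 0, ∃ (p q : E) (A : E →L[ℝ] E), ‖p‖ < ε ∧ ‖q‖ ≤ R ∧ ‖A‖ ≤ L ∧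
      (∀ a b, ⟪A a, b⟫ = ⟪A b, a⟫) ∧ (∃ y ∈ Ω, IsUpperJet Ω u y q A) ∧
      ∃ y' ∈ Ω, IsUpperJet Ω w y' (p - q) (-A) := by
  obtain ⟨c, hc, δ, hδ, hinter⟩ := exists_interior_maximizers hΩo hΩk hu hw hx₀ hm hfr
  obtain ⟨R, hR0, hR⟩ := hΩk.isBounded.exists_pos_norm_le
  have hne : (closure Ω).Nonempty := ⟨x₀, subset_closure hx₀⟩
  obtain ⟨h, g, hb, habove, hleast⟩ := exists_double_envelope hΩk hne hu hc
  obtain ⟨h', g', hb', habove', hleast'⟩ := exists_double_envelope hΩk hne hw hc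
  have hlip : LipschitzWith (6 * ⟨6 * c, by positivity⟩) g := lipschitzWith_of_quadratic_bound hb
  have hlip' : LipschitzWith (6 * ⟨6 * c, by positivity⟩) g' := lipschitzWith_of_quadratic_bound hb'
  have hgrad : ∀ x, HasGradientAt h (g x) x := fun x => hasGradientAt_of_quadratic_bound (hb x)
  set K : ℝ → Set E := fun ε => {x | ∃ p : E, ‖p‖ < ε ∧ ∃ y ∈ Ω, ∃ y' ∈ Ω, ∃ M : ℝ,
    g x + g' x = p ∧ g x = (4 * c) • (y - x) ∧ ‖g x‖ ≤ 4 * c * R + ‖p‖ ∧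
    h x = u y - 2 * c * ‖x - y‖ ^ 2 ∧
    h x = -w y' + 2 * c * ‖x - y'‖ ^ 2 + ⟪p, x⟫ + M ∧
    ∀ z, ∀ z' ∈ closure Ω, h z ≤ -w z' + 2 * c * ‖z - z'‖ ^ 2 + ⟪p, z⟫ + M} with hK
  have hcontact : ∀ ε, ε ≤ δ → ball 0 ε ⊆ (fun x => g x + g' x) '' K ε := by
    intro ε hε p hp
    rw [mem_ball_zero_iff] at hp
    obtain ⟨y, hy, y', hy', hmax⟩ := hinter p (hp.trans_le hε)
    set x := (1 / 2 : ℝ) • (y + y') - (1 / (8 * c)) • p with hx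
    set M := u y + w y' - c * ‖y - y'‖ ^ 2 - ⟪p, (1 / 2 : ℝ) • (y + y')⟫
      + 1 / (16 * c) * ‖p‖ ^ 2 with hM
    have hΨ : ∀ z, ∀ a ∈ closure Ω, ∀ b ∈ closure Ω,
        u a + w b - 2 * c * ‖z - a‖ ^ 2 - 2 * c * ‖z - b‖ ^ 2 - ⟪p, z⟫ ≤ M := by
      intro z a ha b hb
      have h1 := doubled_square_identity hc p z a b
      have h2 := hmax a ha b hb
      have h3 : 0 ≤ 4 * c * ‖z - ((1 / 2 : ℝ) • (a + b) - (1 / (8 * c)) • p)‖ ^ 2 := by positivity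
      rw [hM]; linarith
    have hΨx : u y + w y' - 2 * c * ‖x - y‖ ^ 2 - 2 * c * ‖x - y'‖ ^ 2 - ⟪p, x⟫ = M := by
      have h1 := doubled_square_identity hc p x y y'
      rw [← hx, sub_self, norm_zero] at h1
      rw [hM]; linarith
    have hyc := subset_closure hy
    have hyc' := subset_closure hy'
    have hle : ∀ z, ∀ b ∈ closure Ω, h z ≤ -w b + 2 * c * ‖z - b‖ ^ 2 + ⟪p, z⟫ + M := by
      intro z b hb
      have := hleast (-w b + M) p b (fun x' a ha => by linarith [hΨ x' a ha b hb]) z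
      linarith
    have hle' : ∀ z, ∀ a ∈ closure Ω, h' z ≤ -u a + 2 * c * ‖z - a‖ ^ 2 + ⟪p, z⟫ + M := by
      intro z a ha
      have := hleast' (-u a + M) p a (fun x' b hb => by linarith [hΨ x' a ha b hb]) z
      linarith
    have heq : h x = u y - 2 * c * ‖x - y‖ ^ 2 :=
      le_antisymm (by linarith [hle x y' hyc']) (habove x y hyc)
    have heq' : h' x = w y' - 2 * c * ‖x - y'‖ ^ 2 :=
      le_antisymm (by linarith [hle' x y hyc]) (habove' x y' hyc')
    have hgx : g x = (4 * c) • (y - x) :=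
      slope_eq_of_touching (hb x) (fun z => habove z y hyc) heq
    have hgx' : g' x = (4 * c) • (y' - x) :=
      slope_eq_of_touching (hb' x) (fun z => habove' z y' hyc') heq'
    have hsum : g x + g' x = p := by
      have e : g x + g' x = (4 * c) • ((2 : ℝ) • ((1 / (8 * c)) • p)) := by
        rw [hgx, hgx', hx]; module
      rw [e, smul_smul, smul_smul]
      convert one_smul ℝ p using 2
      field_simp
      norm_num
    have hbd : ‖g x‖ ≤ 4 * c * R + ‖p‖ := by
      have e : g x = (2 * c) • (y - y') + (1 / 2 : ℝ) • p := by
        have e1 : g x = (2 * c) • (y - y') + (4 * c * (1 / (8 * c))) • p := by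
          rw [hgx, hx]; module
        rw [e1]; congr 2; field_simp; norm_num
      rw [e]
      refine (norm_add_le _ _).trans ?_
      rw [norm_smul, norm_smul, Real.norm_eq_abs, Real.norm_eq_abs, abs_of_pos (by positivity),
        abs_of_pos (by norm_num)]
      have h1 : ‖y - y'‖ ≤ 2 * R := by
        linarith [norm_sub_le y y', hR y hyc, hR y' hyc']
      nlinarith [norm_nonneg p, mul_le_mul_of_nonneg_left h1 hc.le]
    exact ⟨x, ⟨p, hp, y, hy, y', hy', M, hsum, hgx, hbd, heq, by linarith, hle⟩, hsum⟩
  borelize E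
  refine ⟨4 * c * R + δ, (6 * ⟨6 * c, by positivity⟩ : ℝ≥0), fun ε hε => ?_⟩
  obtain ⟨x, ⟨p, hp, y, hy, y', hy', M, -, hgx, hbd, heq, heq₂, hle⟩, hdiff⟩ :=
    exists_differentiableAt_of_ball_subset_image (hlip.add hlip') hlip (lt_min hε hδ)
      (hcontact (min ε δ) (min_le_right _ _))
  have hA := hdiff.hasFDerivAt
  refine ⟨p, g x, fderiv ℝ g x, hp.trans_le (min_le_left _ _), ?_,
    norm_fderiv_le_of_lipschitz ℝ hlip, derivative_of_gradient_symmetric hgrad hA,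
    ⟨y, hy, fun η hη => ?_⟩, ⟨y', hy', fun η hη => ?_⟩⟩
  · linarith [hp.trans_le (min_le_right ε δ)]
  · filter_upwards [second_order_expansion hgrad hA hη] with d hd hyd
    have h1 := habove (x + d) (y + d) (subset_closure hyd)
    rw [add_sub_add_right_eq_sub] at h1
    linarith [(abs_le.1 hd).2]
  · filter_upwards [second_order_expansion hgrad hA hη] with d hd hyd
    have h1 := hle (x + d) (y' + d) (subset_closure hyd)
    rw [add_sub_add_right_eq_sub, inner_add_right] at h1
    rw [inner_sub_left, neg_apply, inner_neg_left]
    linarith [(abs_le.1 hd).1]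

end

section
variable {n : ℕ}

/-- Comparison for strictly ordered right-hand sides. -/
theorem strict_comparison {H : En n → Sym n → ℝ}
    (hH : Continuous fun q : En n × Sym n => H q.1 q.2) {Ω : Set (En n)} (hΩo : IsOpen Ω)
    (hΩk : IsCompact (closure Ω)) {s t : ℝ} (hst : s < t) {u v : En n → ℝ}
    (hu : UpperSemicontinuousOn u (closure Ω)) (hv : LowerSemicontinuousOn v (closure Ω))
    (hsub : EllSub H Ω u fun _ => t) (hsuper : EllSuper H Ω v fun _ => s) {m : ℝ}
    (hfr : ∀ y ∈ frontier Ω, u y - v y ≤ m) {x : En n} (hx : x ∈ Ω) : u x - v x ≤ m := by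
  by_contra! hm
  have hw : UpperSemicontinuousOn (fun y => -v y) (closure Ω) := fun y hy a ha => by
    filter_upwards [hv y hy (-a) (show -a < v y from neg_lt.1 ha)] with z hz
    exact neg_lt.1 (show -a < v z from hz)
  obtain ⟨R, L, hjets⟩ := exists_opposite_jets hΩo hΩk hu hw hx (m := m)
    (by linarith) fun y hy => by linarith [hfr y hy]
  have hneg : Continuous fun q : En n × Sym n => -H (-q.1) (-q.2) :=
    (hH.comp (continuous_fst.neg.prodMk continuous_snd.neg)).neg
  have hseq : ∀ N : ℕ, ∃ (p q : En n) (A : En n →L[ℝ] En n), ‖p‖ < 1 / ((N : ℝ) + 1) ∧ ‖q‖ ≤ R ∧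
      ‖A‖ ≤ L ∧ t ≤ H q (formMatrix A) ∧ H (q - p) (formMatrix A) ≤ s := by
    intro N
    obtain ⟨p, q, A, hp, hq, hAL, hsym, ⟨y, hy, hjet⟩, y', hy', hjet'⟩ :=
      hjets (1 / ((N : ℝ) + 1)) Nat.one_div_pos_of_nat
    refine ⟨p, q, A, hp, hq, hAL, hsub.le_of_upper_jet hH hy hsym hjet, ?_⟩
    have h1 := hsuper.neg.le_of_upper_jet hneg hy' (fun a b => by
      rw [neg_apply, neg_apply, inner_neg_left, inner_neg_left, hsym]) hjet'
    rw [formMatrix_neg, neg_neg, neg_sub] at h1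
    linarith
  choose p q A hp hq hA ht hs using hseq
  obtain ⟨⟨q₀, A₀⟩, -, φ, hφ, hlim⟩ :=
    ((isCompact_closedBall (0 : En n) R).prod
      (isCompact_closedBall (0 : En n →L[ℝ] En n) L)).tendsto_subseq (x := fun N => (q N, A N))
      fun N => ⟨mem_closedBall_zero_iff.2 (hq N), mem_closedBall_zero_iff.2 (hA N)⟩
  have hp0 : Tendsto (fun N => p (φ N)) atTop (𝓝 0) :=
    (squeeze_zero_norm (fun N => (hp N).le) tendsto_one_div_add_atTop_nhds_zero_nat).comp
      hφ.tendsto_atTop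
  have hqlim : Tendsto (fun N => q (φ N)) atTop (𝓝 q₀) := hlim.fst_nhds
  have hAlim : Tendsto (fun N => formMatrix (A (φ N))) atTop (𝓝 (formMatrix A₀)) :=
    (continuous_formMatrix.tendsto A₀).comp hlim.snd_nhds
  have hqp : Tendsto (fun N => q (φ N) - p (φ N)) atTop (𝓝 q₀) := by
    simpa using hqlim.sub hp0
  have h1 : t ≤ H q₀ (formMatrix A₀) :=
    ge_of_tendsto ((hH.tendsto (q₀, formMatrix A₀)).comp (hqlim.prodMk_nhds hAlim))
      (Eventually.of_forall fun N => ht (φ N))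
  have h2 : H q₀ (formMatrix A₀) ≤ s :=
    le_of_tendsto ((hH.tendsto (q₀, formMatrix A₀)).comp (hqp.prodMk_nhds hAlim))
      (Eventually.of_forall fun N => hs (φ N))
  linarith

/-- Positive multiples of subsolutions of a homogeneous equation. -/
theorem EllSub.smul {H : En n → Sym n → ℝ} {k₁ : ℝ} (hB : CondB H k₁) {Ω : Set (En n)}
    {u : En n → ℝ} {t : ℝ} (hu : EllSub H Ω u fun _ => t) {θ : ℝ} (hθ : 0 < θ) :
    EllSub H Ω (fun x => θ * u x) fun _ => θ ^ k₁ * (θ * t) := by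
  intro φ hφ y hy hmax
  have h1 := hu (fun x => θ⁻¹ * φ x) (contDiff_const.mul hφ) y hy (by
    filter_upwards [hmax] with x hx
    have h2 := mul_le_mul_of_nonneg_left hx (inv_pos.2 hθ).le
    rw [mul_sub, mul_sub, inv_mul_cancel_left₀ hθ.ne', inv_mul_cancel_left₀ hθ.ne'] at h2
    exact h2)
  have hf : ∀ x, fderiv ℝ (fun x => θ⁻¹ * φ x) x = θ⁻¹ • fderiv ℝ φ x := fun x =>
    fderiv_const_mul (hφ.differentiable (by norm_num) x) _
  have hg : gradient φ y = θ • gradient (fun x => θ⁻¹ * φ x) y := by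
    simp only [gradient, hf, map_smul]
    rw [smul_inv_smul₀ hθ.ne']
  have hd : Differentiable ℝ (fderiv ℝ φ) :=
    (hφ.fderiv_right (m := 1) (by norm_num)).differentiable (by norm_num)
  have hh : ehess φ y = θ • ehess (fun x => θ⁻¹ * φ x) y := by
    ext i j
    simp only [ehess, hf, Matrix.of_apply, Matrix.smul_apply, smul_apply, smul_eq_mul]
    rw [fderiv_const_mul ((hd y).clm_apply (differentiableAt_const _)), smul_apply, smul_eq_mul,
      mul_inv_cancel_left₀ hθ.ne']
  rw [hg, hh, hB.2.1, hB.2.2 θ hθ, abs_of_pos hθ]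
  exact mul_le_mul_of_nonneg_left (mul_le_mul_of_nonneg_left h1 hθ.le)
    (Real.rpow_nonneg hθ.le _)

end

theorem le_of_forall_le_add_mul {a b c : ℝ} (h : ∀ δ, 0 < δ → δ < 1 → a ≤ b + δ * c) : a ≤ b := by
  have hlim : Tendsto (fun δ : ℝ => b + δ * c) (𝓝[>] 0) (𝓝 b) := by
    have : Tendsto (fun δ : ℝ => b + δ * c) (𝓝 0) (𝓝 (b + 0 * c)) :=
      Continuous.tendsto (by fun_prop) 0
    rw [zero_mul, add_zero] at this
    exact this.mono_left nhdsWithin_le_nhds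
  refine ge_of_tendsto hlim ?_
  filter_upwards [Ioo_mem_nhdsGT one_pos] with δ hδ
  exact h δ hδ.1 hδ.2

theorem upperSemicontinuousOn_const_mul {X : Type*} [TopologicalSpace X] {K : Set X} {f : X → ℝ}
    (hf : UpperSemicontinuousOn f K) {θ : ℝ} (hθ : 0 < θ) :
    UpperSemicontinuousOn (fun x => θ * f x) K := fun x hx a ha => by
  filter_upwards [hf x hx (a / θ) ((lt_div_iff₀' hθ).2 ha)] with z hz
  exact (lt_div_iff₀' hθ).1 hz

end

/-- elliptic comparison principle for H(Du,D²u) ≥ t, H(Dv,D²v) ≤ s,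
s ≤ t, |s| + |t| > 0. -/
theorem elliptic_comparison
    {n : ℕ} (hn : 2 ≤ n)
    (H : En n → Sym n → ℝ) (k₁ k : ℝ) (hk : k = k₁ + 1)
    (hA : CondA H) (hB : CondB H k₁)
    (Ω : Set (En n)) (hΩo : IsOpen Ω) (hΩc : IsConnected Ω)
    (hΩb : Bornology.IsBounded Ω)
    (s t : ℝ) (hst : s ≤ t) (hst0 : 0 < |s| + |t|)
    (u v : En n → ℝ)
    (husc : UpperSemicontinuousOn u (closure Ω))
    (hlsc : LowerSemicontinuousOn v (closure Ω))
    (hsub : EllSub H Ω u (fun _ => t))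
    (hsuper : EllSuper H Ω v (fun _ => s)) :
    ∀ x ∈ Ω, u x - v x ≤ sSup ((fun y => u y - v y) '' frontier Ω) := by
  intro x hx
  have hΩk : IsCompact (closure Ω) := hΩb.isCompact_closure
  obtain ⟨M, hM⟩ := husc.bddAbove_of_isCompact hΩk
  obtain ⟨B, hB'⟩ := hlsc.bddBelow_of_isCompact hΩk
  have hu : ∀ y ∈ closure Ω, u y ≤ M := fun y hy => hM (mem_image_of_mem u hy)
  have hv : ∀ y ∈ closure Ω, B ≤ v y := fun y hy => hB' (mem_image_of_mem v hy)
  have hcl : ∀ y ∈ frontier Ω, y ∈ closure Ω := fun y hy => frontier_subset_closure hy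
  have hfr : ∀ y ∈ frontier Ω, u y - v y ≤ sSup ((fun y => u y - v y) '' frontier Ω) := by
    intro y hy
    refine le_csSup ⟨M - B, ?_⟩ (mem_image_of_mem (fun y => u y - v y) hy)
    rintro _ ⟨z, hz, rfl⟩
    exact sub_le_sub (hu z (hcl z hz)) (hv z (hcl z hz))
  set m := sSup ((fun y => u y - v y) '' frontier Ω)
  rcases hst.lt_or_eq with h | rfl
  · exact strict_comparison hA.1 hΩo hΩk h husc hlsc hsub hsuper hfr hx
  have hscale : ∀ θ : ℝ, 0 < θ → s < θ ^ k₁ * (θ * s) → ∀ m' : ℝ,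
      (∀ y ∈ frontier Ω, θ * u y - v y ≤ m') → θ * u x - v x ≤ m' := fun θ hθ h m' hm' =>
    strict_comparison hA.1 hΩo hΩk h (upperSemicontinuousOn_const_mul husc hθ) hlsc
      (hsub.smul hB hθ) hsuper hm' hx
  have hs : s ≠ 0 := by
    rintro rfl
    simp at hst0
  rcases hs.lt_or_gt with hs | hs
  · refine le_of_forall_le_add_mul (c := u x - m - B) fun δ hδ hδ1 => ?_
    have hpow := Real.rpow_le_one (sub_nonneg.2 hδ1.le) (by linarith : 1 - δ ≤ 1) hB.1
    have := hscale (1 - δ) (sub_pos.2 hδ1) (by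
      nlinarith [mul_nonneg (sub_nonneg.2 hpow) (mul_nonneg (sub_nonneg.2 hδ1.le) (neg_pos.2 hs).le),
        mul_pos hδ (neg_pos.2 hs)]) ((1 - δ) * m + δ * (-B)) fun y hy => by
      nlinarith [mul_le_mul_of_nonneg_left (hfr y hy) (sub_nonneg.2 hδ1.le),
        mul_le_mul_of_nonneg_left (hv y (hcl y hy)) hδ.le]
    linarith
  · refine le_of_forall_le_add_mul (c := M - u x) fun δ hδ _ => ?_
    have hpow := Real.one_le_rpow (by linarith : 1 ≤ 1 + δ) hB.1
    have := hscale (1 + δ) (by linarith) (by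
      nlinarith [mul_nonneg (sub_nonneg.2 hpow) (mul_pos (by linarith : 0 < 1 + δ) hs).le,
        mul_pos hδ hs]) (m + δ * M) fun y hy => by
      nlinarith [hfr y hy, mul_le_mul_of_nonneg_left (hu y (hcl y hy)) hδ.le]
    linarith

end DNLP
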